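/- arXiv:2304.05569 — 4 statements merged into one kernel-verified Lean document; each statement's English description precedes it below -/
import Mathlib

section
/- If |θ| < R^{2s}/(2sL), then for every r ≥ 0 one has r^{2s} + 2sθ χ_R(r^{2s}) ≥ 0, and the map F : [0,∞) → [0,∞) defined by F(r) = (r^{2s} + 2sθ χ_R(r^{2s}))^{1/(2s)} is a bijection from [0,∞) onto [0,∞). -/
open Set Filter

lemma bijOn_rpow_Ici {p : ℝ} (hp : 0 < p) :
    BijOn (fun r : ℝ => r ^ p) (Ici 0) (Ici 0) := by
  refine ⟨fun r hr => Real.rpow_nonneg hr p, Real.rpow_left_injOn hp.ne', fun y hy => ?_⟩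
  exact ⟨y ^ p⁻¹, Real.rpow_nonneg hy _, Real.rpow_inv_rpow hy hp.ne'⟩

/-- A perturbation of the identity by a Lipschitz function of constant less than one is
strictly monotone. -/
lemma strictMono_id_add_of_abs_sub_le {f : ℝ → ℝ} {K : ℝ} (hK : K < 1)
    (hf : ∀ x y, |f x - f y| ≤ K * |x - y|) : StrictMono fun t => t + f t := by
  intro x y hxy
  have h := (le_abs_self _).trans (hf x y)
  rw [abs_sub_comm, abs_of_pos (sub_pos.2 hxy)] at h
  have : K * (y - x) < 1 * (y - x) := mul_lt_mul_of_pos_right hK (sub_pos.2 hxy)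
  show x + f x < y + f y
  linarith

lemma bijOn_Ici_of_strictMono {g : ℝ → ℝ} (hg : StrictMono g) (hc : Continuous g)
    (ht : Tendsto g atTop atTop) (h0 : g 0 = 0) : BijOn g (Ici 0) (Ici 0) := by
  refine ⟨fun t ht0 => h0 ▸ hg.monotone ht0, hg.injective.injOn, fun y hy => ?_⟩
  obtain ⟨b, hb, hyb⟩ := ((eventually_ge_atTop 0).and (ht.eventually_ge_atTop y)).exists
  obtain ⟨t, ht0, rfl⟩ := intermediate_value_Icc hb hc.continuousOn ⟨h0.symm ▸ hy, hyb⟩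
  exact ⟨t, ht0.1, rfl⟩

/-- If `|θ| < R^{2s}/(2sL)`, then `r^{2s} + 2sθ χ_R(r^{2s}) ≥ 0` for all
`r ≥ 0`, and `F(r) = (r^{2s} + 2sθ χ_R(r^{2s}))^{1/(2s)}` is a bijection from `[0,∞)`
onto `[0,∞)`. -/
theorem stmt2 (s R L θ : ℝ) (hs : s ∈ Set.Ioo (0:ℝ) 1) (hR : 0 < R) (hL : 0 < L)
    (χR : ℝ → ℝ) (hχR : ∀ t, χR t ∈ Set.Icc (0:ℝ) 1)
    (hχR0 : ∀ t : ℝ, t ≤ R ^ (2*s) → χR t = 0)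
    (hχR1 : ∀ t : ℝ, 2 * R ^ (2*s) ≤ t → χR t = 1)
    (hLip : ∀ t₁ t₂ : ℝ, |χR t₁ - χR t₂| ≤ L * R ^ (-(2*s)) * |t₁ - t₂|)
    (hθ : |θ| < R ^ (2*s) / (2*s*L)) :
    (∀ r : ℝ, 0 ≤ r → 0 ≤ r ^ (2*s) + 2*s*θ*χR (r ^ (2*s))) ∧
    Set.BijOn (fun r : ℝ => (r ^ (2*s) + 2*s*θ*χR (r ^ (2*s))) ^ (1/(2*s)))
      (Set.Ici 0) (Set.Ici 0) := by
  have hp : 0 < 2 * s := by linarith [hs.1]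
  have hRp : 0 < R ^ (2*s) := Real.rpow_pos_of_pos hR _
  have hK : |2*s*θ| * (L * R ^ (-(2*s))) < 1 := by
    rw [lt_div_iff₀ (by positivity)] at hθ
    rw [Real.rpow_neg hR.le, abs_mul, abs_of_pos hp, ← mul_assoc, ← div_eq_mul_inv,
      div_lt_one hRp]
    linarith
  have hLip' : ∀ x y, |2*s*θ*χR x - 2*s*θ*χR y| ≤
      |2*s*θ| * (L * R ^ (-(2*s))) * |x - y| := fun x y => by
    rw [← mul_sub, abs_mul, mul_assoc |2*s*θ|]
    exact mul_le_mul_of_nonneg_left (hLip x y) (abs_nonneg _)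
  have hχc : Continuous χR := by
    refine (LipschitzWith.of_dist_le_mul (K := (L * R ^ (-(2*s))).toNNReal)
      fun x y => ?_).continuous
    rw [Real.coe_toNNReal _ (by positivity)]
    exact hLip x y
  have hlim : Tendsto (fun t => t + 2*s*θ*χR t) atTop atTop := by
    refine tendsto_atTop_add_right_of_le atTop (-|2*s*θ|) tendsto_id fun t => ?_
    refine (abs_le.1 ?_).1
    rw [abs_mul, abs_of_nonneg (hχR t).1]
    exact mul_le_of_le_one_right (abs_nonneg _) (hχR t).2
  have hg : BijOn (fun t => t + 2*s*θ*χR t) (Ici 0) (Ici 0) :=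
    bijOn_Ici_of_strictMono (strictMono_id_add_of_abs_sub_le hK hLip') (by fun_prop) hlim
      (by simp [hχR0 0 hRp.le])
  have hgp := hg.comp (bijOn_rpow_Ici hp)
  exact ⟨fun r hr => hgp.mapsTo hr, (bijOn_rpow_Ici (one_div_pos.2 hp)).comp hgp⟩
end

section
/- There exists L₁ > 0 such that for every θ ∈ ℝ with |θ| < L₁, one has r² + 2θ χ_R(r²) log r ≥ 0 for all r ≥ 0, and the map G : [0,∞) → [0,∞) defined by G(r) = (r² + 2θ χ_R(r²) log r)^{1/2} is a bijection from [0,∞) onto [0,∞). -/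
/-- A cutoff function `χ`, Lipschitz with constant `M`, vanishing up to `a > 0` and equal to `1`
from `2 * a` on, makes `χ * log` Lipschitz. -/
theorem abs_cutoff_mul_log_sub_le {a M : ℝ} (ha : 0 < a) (hM : 0 ≤ M) {χ : ℝ → ℝ}
    (hχ : ∀ t, χ t ∈ Set.Icc (0:ℝ) 1) (hχ0 : ∀ t, t ≤ a → χ t = 0)
    (hχ1 : ∀ t, 2 * a ≤ t → χ t = 1) (hLip : ∀ s t, |χ s - χ t| ≤ M * |s - t|) (s t : ℝ) :
    |χ s * Real.log s - χ t * Real.log t| ≤ (1 / a + M * (|Real.log a| + 1)) * |s - t| := by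
  have key : ∀ s t : ℝ, a ≤ s → s ≤ t → |χ s * Real.log s - χ t * Real.log t| ≤
      (1 / a + M * (|Real.log a| + 1)) * |s - t| := by
    intro s t has hst
    have hs : 0 < s := ha.trans_le has
    have ht : 0 < t := hs.trans_le hst
    have hlog : |Real.log s - Real.log t| ≤ 1 / a * |s - t| := by
      rw [abs_sub_comm, abs_sub_comm s t, abs_of_nonneg (sub_nonneg.2 hst),
        abs_of_nonneg (sub_nonneg.2 (Real.log_le_log hs hst)), ← Real.log_div ht.ne' hs.ne']
      calc Real.log (t / s) ≤ t / s - 1 := Real.log_le_sub_one_of_pos (by positivity)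
        _ = 1 / s * (t - s) := by field_simp
        _ ≤ 1 / a * (t - s) := by
          have := sub_nonneg.2 hst
          gcongr
    have h1 : |χ t * (Real.log s - Real.log t)| ≤ 1 / a * |s - t| := by
      rw [abs_mul, abs_of_nonneg (hχ t).1]
      exact (mul_le_of_le_one_left (abs_nonneg _) (hχ t).2).trans hlog
    have h2 : |(χ s - χ t) * Real.log s| ≤ M * (|Real.log a| + 1) * |s - t| := by
      rcases le_total (2 * a) s with h | h
      · rw [hχ1 s h, hχ1 t (h.trans hst), sub_self, zero_mul, abs_zero]
        positivity
      · have hls : |Real.log s| ≤ |Real.log a| + 1 := by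
          have hl := Real.log_le_log ha has
          have hu := Real.log_le_log hs h
          rw [Real.log_mul two_ne_zero ha.ne'] at hu
          have h2 := Real.log_two_lt_d9
          rw [abs_le]
          constructor <;> linarith [neg_abs_le (Real.log a), le_abs_self (Real.log a)]
        rw [abs_mul]
        calc |χ s - χ t| * |Real.log s| ≤ (M * |s - t|) * (|Real.log a| + 1) := by
              gcongr
              exact hLip s t
          _ = _ := by ring
    calc |χ s * Real.log s - χ t * Real.log t|
        = |χ t * (Real.log s - Real.log t) + (χ s - χ t) * Real.log s| := by ring_nf
      _ ≤ _ := abs_add_le _ _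
      _ ≤ _ := by linarith
  have key' : ∀ s t : ℝ, a ≤ s → a ≤ t → |χ s * Real.log s - χ t * Real.log t| ≤
      (1 / a + M * (|Real.log a| + 1)) * |s - t| := by
    intro s t hs ht
    rcases le_total s t with h | h
    · exact key s t hs h
    · rw [abs_sub_comm, abs_sub_comm s t]
      exact key t s ht h
  have hmax : ∀ t, χ t * Real.log t = χ (max t a) * Real.log (max t a) := by
    intro t
    rcases le_total t a with h | h
    · rw [max_eq_right h, hχ0 t h, hχ0 a le_rfl, zero_mul, zero_mul]
    · rw [max_eq_left h]
  rw [hmax s, hmax t]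
  refine (key' _ _ (le_max_right _ _) (le_max_right _ _)).trans ?_
  gcongr ?_ * ?_
  exact abs_max_sub_max_le_abs s t a

/-- If `g` is Lipschitz with constant `c < 1` and `g 0 = 0`, then `r ↦ (r ^ 2 + g (r ^ 2)) ^ (1 / 2)`
is a well-defined bijection of `[0, ∞)`. -/
theorem bijOn_rpow_half_sq_add {g : ℝ → ℝ} {c : ℝ} (hc : c < 1) (hg0 : g 0 = 0)
    (hg : ∀ s t, |g s - g t| ≤ c * |s - t|) :
    (∀ r : ℝ, 0 ≤ r ^ 2 + g (r ^ 2)) ∧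
      Set.BijOn (fun r : ℝ => (r ^ 2 + g (r ^ 2)) ^ ((1:ℝ)/2)) (Set.Ici 0) (Set.Ici 0) := by
  have hlow : ∀ s t, s ≤ t → (1 - c) * (t - s) ≤ (t + g t) - (s + g s) := by
    intro s t hst
    have h := hg s t
    rw [abs_sub_comm s t, abs_of_nonneg (sub_nonneg.2 hst)] at h
    linarith [le_abs_self (g s - g t)]
  have hlow0 : ∀ t, 0 ≤ t → (1 - c) * t ≤ t + g t := by
    intro t ht
    simpa [hg0] using hlow 0 t ht
  have hc' : 0 < 1 - c := sub_pos.2 hc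
  have hnonneg : ∀ r : ℝ, 0 ≤ r ^ 2 + g (r ^ 2) := fun r =>
    (mul_nonneg hc'.le (sq_nonneg r)).trans (hlow0 _ (sq_nonneg r))
  have hmono : StrictMono fun t => t + g t := by
    intro s t hst
    linarith [hlow s t hst.le, mul_pos hc' (sub_pos.2 hst)]
  have hcont : Continuous g :=
    (LipschitzWith.of_dist_le_mul (K := c.toNNReal) fun s t => by
      rw [Real.dist_eq, Real.dist_eq]
      exact (hg s t).trans
        (mul_le_mul_of_nonneg_right (Real.le_coe_toNNReal c) (abs_nonneg _))).continuous
  simp only [← Real.sqrt_eq_rpow]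
  refine ⟨hnonneg, fun r _ => Real.sqrt_nonneg _, ?_, ?_⟩
  · intro r hr s hs h
    have h' := hmono.injective ((Real.sqrt_inj (hnonneg r) (hnonneg s)).1 h)
    exact (sq_eq_sq₀ hr hs).1 h'
  · intro y hy
    have hM : 0 ≤ y ^ 2 / (1 - c) := by positivity
    have hmem : y ^ 2 ∈ Set.Icc (0 + g 0) (y ^ 2 / (1 - c) + g (y ^ 2 / (1 - c))) := by
      refine ⟨by simpa [hg0] using sq_nonneg y, ?_⟩
      have := hlow0 _ hM
      rwa [mul_div_cancel₀ _ hc'.ne'] at this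
    obtain ⟨t, ht, hty⟩ := intermediate_value_Icc (f := fun t => t + g t) hM
      (continuous_id.add hcont).continuousOn hmem
    refine ⟨√t, Real.sqrt_nonneg t, ?_⟩
    simp only at hty ⊢
    rw [Real.sq_sqrt ht.1, hty, Real.sqrt_sq hy]


/-- There exists `L₁ > 0` such that for every `θ` with `|θ| < L₁`,
`r² + 2θ χ_R(r²) log r ≥ 0` for all `r ≥ 0`, and
`G(r) = (r² + 2θ χ_R(r²) log r)^{1/2}` is a bijection from `[0,∞)` onto `[0,∞)`. -/
theorem stmt3 (R L : ℝ) (hR : 0 < R) (hL : 0 < L)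
    (χR : ℝ → ℝ) (hχR : ∀ t, χR t ∈ Set.Icc (0:ℝ) 1)
    (hχR0 : ∀ t : ℝ, t ≤ R ^ 2 → χR t = 0)
    (hχR1 : ∀ t : ℝ, 2 * R ^ 2 ≤ t → χR t = 1)
    (hLip : ∀ t₁ t₂ : ℝ, |χR t₁ - χR t₂| ≤ L / R ^ 2 * |t₁ - t₂|) :
    ∃ L₁ > (0:ℝ), ∀ θ : ℝ, |θ| < L₁ →
      (∀ r : ℝ, 0 ≤ r → 0 ≤ r ^ 2 + 2*θ*χR (r ^ 2)*Real.log r) ∧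
      Set.BijOn (fun r : ℝ => (r ^ 2 + 2*θ*χR (r ^ 2)*Real.log r) ^ ((1:ℝ)/2))
        (Set.Ici 0) (Set.Ici 0) := by
  have ha : 0 < R ^ 2 := by positivity
  set K := 1 / R ^ 2 + L / R ^ 2 * (|Real.log (R ^ 2)| + 1) with hK
  have hKpos : 0 < K := by positivity
  refine ⟨1 / K, by positivity, fun θ hθ => ?_⟩
  have hfun : ∀ r : ℝ, r ^ 2 + 2 * θ * χR (r ^ 2) * Real.log r =
      r ^ 2 + θ * (χR (r ^ 2) * Real.log (r ^ 2)) := by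
    intro r
    rw [Real.log_pow]
    push_cast
    ring
  simp only [hfun]
  have h := bijOn_rpow_half_sq_add (g := fun t => θ * (χR t * Real.log t)) (c := |θ| * K)
    ((lt_div_iff₀ hKpos).1 hθ) (by simp) fun s t => by
      rw [← mul_sub, abs_mul, mul_assoc]
      exact mul_le_mul_of_nonneg_left
        (abs_cutoff_mul_log_sub_le ha (by positivity) hχR hχR0 hχR1 hLip s t) (abs_nonneg θ)
  exact ⟨fun r _ => h.1 r, h.2⟩
end

section
/- Let s ∈ (0,1), let q : ℝ^d → ℝ be differentiable, let E ∈ ℝ, let x ∈ ℝ^d with x ≠ 0, and let λ ∈ ℝ satisfy (1/2)λ² − (1/2)|x|^{2s} + q(x) = E. Set ω = x/|x| and ξ = λω. Then ⟨ξ, ∇ₓ a_ξ(x)⟩ − ⟨∇(−(1/2)|·|^{2s} + q)(x), |x|^{−2s} x⟩ = 1 − s − 2(1−2s)|x|^{−2s}(q(x) − E) − |x|^{1−2s} ⟨ω, ∇q(x)⟩, where a_ξ : ℝ^d → ℝ is the function a_ξ(y) = |y|^{−2s} ⟨y, ξ⟩ and ∇ denotes the gradient. -/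
open scoped InnerProductSpace

theorem hasFDerivAt_norm_rpow_of_ne_zero {F : Type*} [NormedAddCommGroup F]
    [InnerProductSpace ℝ F] {x : F} (hx : x ≠ 0) (p : ℝ) :
    HasFDerivAt (fun y : F => ‖y‖ ^ p) ((p * ‖x‖ ^ (p - 2)) • innerSL ℝ x) x := by
  apply HasStrictFDerivAt.hasFDerivAt
  convert! (hasStrictFDerivAt_norm_sq x).rpow_const (p := p / 2) (by simp [hx]) using 0
  simp_rw [← Real.rpow_natCast_mul (norm_nonneg _), ← Nat.cast_smul_eq_nsmul ℝ, smul_smul]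
  ring_nf

/-- Poisson bracket computation for the sub-quadratic conjugate function:
with `ω = x/|x|`, `ξ = λω`, `a_ξ(y) = |y|^{-2s}⟨y,ξ⟩`, and the energy relation
`(1/2)λ² - (1/2)|x|^{2s} + q(x) = E`, one has
`⟨ξ, ∇a_ξ(x)⟩ - ⟨∇(-(1/2)|·|^{2s} + q)(x), |x|^{-2s}x⟩
  = 1 - s - 2(1-2s)|x|^{-2s}(q(x)-E) - |x|^{1-2s}⟨ω, ∇q(x)⟩`. -/
theorem stmt14 (d : ℕ) (hd : 1 ≤ d) (s : ℝ) (hs : s ∈ Set.Ioo (0:ℝ) 1)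
    (q : EuclideanSpace ℝ (Fin d) → ℝ) (hq : Differentiable ℝ q)
    (E : ℝ) (x : EuclideanSpace ℝ (Fin d)) (hx : x ≠ 0) (lam : ℝ)
    (henergy : (1/2)*lam ^ 2 - (1/2)*‖x‖ ^ (2*s) + q x = E)
    (ω : EuclideanSpace ℝ (Fin d)) (hω : ω = ‖x‖⁻¹ • x)
    (ξ : EuclideanSpace ℝ (Fin d)) (hξ : ξ = lam • ω) :
    ⟪ξ, gradient (fun y => ‖y‖ ^ (-(2*s)) * ⟪y, ξ⟫_ℝ) x⟫_ℝ
      - ⟪gradient (fun y => -(1/2)*‖y‖ ^ (2*s) + q y) x, ‖x‖ ^ (-(2*s)) • x⟫_ℝ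
    = 1 - s - 2*(1 - 2*s)*‖x‖ ^ (-(2*s))*(q x - E)
        - ‖x‖ ^ (1 - 2*s) * ⟪ω, gradient q x⟫_ℝ := by
  have hr : 0 < ‖x‖ := norm_pos_iff.mpr hx
  have ha : HasFDerivAt (fun y => ‖y‖ ^ (-(2*s)) * ⟪y, ξ⟫_ℝ) _ x :=
    (hasFDerivAt_norm_rpow_of_ne_zero hx (-(2*s))).mul
      ((hasFDerivAt_id x).inner ℝ (hasFDerivAt_const ξ x))
  have hV : HasFDerivAt (fun y => -(1/2)*‖y‖ ^ (2*s) + q y) _ x :=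
    ((hasFDerivAt_norm_rpow_of_ne_zero hx (2*s)).const_mul (-(1/2))).add (hq x).hasFDerivAt
  have hneg : ‖x‖ ^ (-(2*s) - 2) = ‖x‖ ^ (-(2*s)) / ‖x‖ ^ 2 := by
    exact_mod_cast Real.rpow_sub_natCast hr.ne' (-(2*s)) 2
  have hpos : ‖x‖ ^ (2*s - 2) = ‖x‖ ^ (2*s) / ‖x‖ ^ 2 := by
    exact_mod_cast Real.rpow_sub_natCast hr.ne' (2*s) 2
  have hone : ‖x‖ ^ (1 - 2*s) = ‖x‖ * ‖x‖ ^ (-(2*s)) := by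
    rw [sub_eq_add_neg, Real.rpow_add hr, Real.rpow_one]
  have hmul : ‖x‖ ^ (2*s) * ‖x‖ ^ (-(2*s)) = 1 := by
    rw [← Real.rpow_add hr, add_neg_cancel, Real.rpow_zero]
  have hlam : lam ^ 2 = 2 * (E - q x) + ‖x‖ ^ (2*s) := by linarith
  rw [inner_gradient_right, inner_gradient_left, inner_gradient_right, ha.fderiv, hV.fderiv, hone]
  subst hω hξ
  simp [real_inner_smul_right, hneg, hpos]
  generalize ‖x‖ ^ (2*s) = A at *
  generalize ‖x‖ ^ (-(2*s)) = B at *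
  field_simp
  linear_combination (1 - 2*s) * B * hlam + (1 - s) * hmul
end

section
/- Let q : ℝ^d → ℝ be differentiable, let E ∈ ℝ, let x ∈ ℝ^d with |x| > 1, and let λ ∈ ℝ satisfy (1/2)λ² − (1/2)|x|² + q(x) = E. Set ω = x/|x| and ξ = λω. Then ⟨ξ, ∇ₓ a_ξ(x)⟩ − ⟨∇(−(1/2)|·|² + q)(x), (log|x|)|x|^{−2} x⟩ = 1 + 2|x|^{−2}(log|x| − 1)(q(x) − E) − |x|^{−1} (log|x|) ⟨ω, ∇q(x)⟩, where a_ξ : ℝ^d → ℝ is the function a_ξ(y) = (log|y|)|y|^{−2} ⟨y, ξ⟩ and ∇ denotes the gradient. -/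
open scoped InnerProductSpace

theorem HasFDerivAt.inner_gradient_left {F : Type*} [NormedAddCommGroup F]
    [InnerProductSpace ℝ F] [CompleteSpace F] {f : F → ℝ} {f' : F →L[ℝ] ℝ} {x : F}
    (h : HasFDerivAt f f' x) (v : F) : ⟪gradient f x, v⟫_ℝ = f' v := by
  rw [gradient, InnerProductSpace.toDual_symm_apply, h.fderiv]

theorem hasFDerivAt_norm_of_ne_zero {F : Type*} [NormedAddCommGroup F] [InnerProductSpace ℝ F]
    {x : F} (hx : x ≠ 0) : HasFDerivAt (fun y : F => ‖y‖) (‖x‖⁻¹ • innerSL ℝ x) x := by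
  have hr : ‖x‖ ≠ 0 := norm_ne_zero_iff.mpr hx
  have h := (hasStrictFDerivAt_norm_sq x).hasFDerivAt.sqrt (pow_ne_zero 2 hr)
  simp only [Real.sqrt_sq (norm_nonneg _)] at h
  convert h using 1
  ext v
  simp
  field_simp

/-- Poisson bracket computation for the inverted harmonic oscillator
conjugate function: with `ω = x/|x|`, `ξ = λω`, `a_ξ(y) = (log|y|)|y|^{-2}⟨y,ξ⟩`, and the
energy relation `(1/2)λ² - (1/2)|x|² + q(x) = E`, one has
`⟨ξ, ∇a_ξ(x)⟩ - ⟨∇(-(1/2)|·|² + q)(x), (log|x|)|x|^{-2}x⟩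
  = 1 + 2|x|^{-2}(log|x| - 1)(q(x)-E) - |x|^{-1}(log|x|)⟨ω, ∇q(x)⟩`. -/
theorem stmt15 (d : ℕ) (hd : 1 ≤ d)
    (q : EuclideanSpace ℝ (Fin d) → ℝ) (hq : Differentiable ℝ q)
    (E : ℝ) (x : EuclideanSpace ℝ (Fin d)) (hx : 1 < ‖x‖) (lam : ℝ)
    (henergy : (1/2)*lam ^ 2 - (1/2)*‖x‖ ^ 2 + q x = E)
    (ω : EuclideanSpace ℝ (Fin d)) (hω : ω = ‖x‖⁻¹ • x)
    (ξ : EuclideanSpace ℝ (Fin d)) (hξ : ξ = lam • ω) :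
    ⟪ξ, gradient (fun y => Real.log ‖y‖ / ‖y‖ ^ 2 * ⟪y, ξ⟫_ℝ) x⟫_ℝ
      - ⟪gradient (fun y => -(1/2)*‖y‖ ^ 2 + q y) x, (Real.log ‖x‖ / ‖x‖ ^ 2) • x⟫_ℝ
    = 1 + 2*(Real.log ‖x‖ - 1)*(q x - E)/‖x‖ ^ 2
        - Real.log ‖x‖ / ‖x‖ * ⟪ω, gradient q x⟫_ℝ := by
  have hr : ‖x‖ ≠ 0 := by positivity
  have hn := hasFDerivAt_norm_of_ne_zero (norm_ne_zero_iff.mp hr)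
  have hlog : HasDerivAt (fun t : ℝ => Real.log t / t ^ 2) _ ‖x‖ :=
    (Real.hasDerivAt_log hr).fun_div (hasDerivAt_pow 2 ‖x‖) (pow_ne_zero 2 hr)
  have ha : HasFDerivAt (fun y => Real.log ‖y‖ / ‖y‖ ^ 2 * ⟪y, ξ⟫_ℝ) _ x :=
    (hlog.comp_hasFDerivAt x hn).mul
      ((hasFDerivAt_id x).inner ℝ (hasFDerivAt_const ξ x))
  have hV : HasFDerivAt (fun y => -(1/2) * ‖y‖ ^ 2 + q y) _ x :=
    ((hasStrictFDerivAt_norm_sq x).hasFDerivAt.const_mul (-(1/2) : ℝ)).add (hq x).hasFDerivAt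
  have hq_ω := (hq x).hasFDerivAt.inner_gradient_left ω
  have hq_x : fderiv ℝ q x x = ‖x‖ * fderiv ℝ q x ω := by
    rw [hω, map_smul, smul_eq_mul, mul_inv_cancel_left₀ hr]
  have hxω : ⟪x, ω⟫_ℝ = ‖x‖ := by
    rw [hω, real_inner_smul_right, real_inner_self_eq_norm_sq]
    field_simp
  have hω_norm : ‖ω‖ = 1 := by rw [hω, norm_smul, norm_inv, norm_norm, inv_mul_cancel₀ hr]
  have hE : q x - E = (‖x‖ ^ 2 - lam ^ 2) / 2 := by linarith
  rw [real_inner_comm, real_inner_comm (gradient q x) ω, ha.inner_gradient_left,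
    hV.inner_gradient_left, hq_ω, hE]
  subst hξ
  simp [real_inner_smul_right, hq_x, hxω, hω_norm]
  field_simp
  ring
end
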